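/- Let P be a probability distribution on a finite set that is not a uniform distribution (so V(P) > 0), with H and V computed with logarithm base 2, and let 0 < ν < 1. Then lim_{n→∞} (L^D_n(U_2, P | ν) − H(P)^{−1}·n)/√n = −√(V(P)/H(P)³) · G^{−1}(ν²); equivalently L^D_n(U_2,P|ν) = H(P)^{−1} n − √(V(P)/H(P)³) G^{−1}(ν²) √n + o(√n), and R^D_2(U_2,P|ν) = −√(V(P)/H(P)³) G^{−1}(ν²). -/

import Mathlib

open MeasureTheory Filter

namespace RNG

variable {α β : Type*}

/-- `P` is a probability distribution on the finite set `α`. -/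
def IsProb [Fintype α] (P : α → ℝ) : Prop :=
  (∀ x, 0 ≤ P x) ∧ ∑ x, P x = 1

open Classical in
/-- Pushforward distribution `W(P)(y) = ∑_{x : W x = y} P x`. -/
noncomputable def push [Fintype α] (W : α → β) (P : α → ℝ) : β → ℝ :=
  fun y => ∑ x, if W x = y then P x else 0

/-- Fidelity (Bhattacharyya coefficient) between distributions on the same finite set. -/
noncomputable def fid [Fintype β] (R S : β → ℝ) : ℝ :=
  ∑ y, Real.sqrt (R y * S y)

/-- Sum of the `l` largest values of `P`, i.e. the `l`-th partial sum of the
decreasing rearrangement of `P` (padded with zeros). -/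
noncomputable def topSum [Fintype α] (P : α → ℝ) (l : ℕ) : ℝ :=
  sSup {s : ℝ | ∃ A : Finset α, A.card ≤ l ∧ s = ∑ x ∈ A, P x}

/-- Majorization `P ≺ P'` (the distributions may live on different finite sets). -/
def Maj [Fintype α] [Fintype β] (P : α → ℝ) (P' : β → ℝ) : Prop :=
  ∀ l : ℕ, topSum P l ≤ topSum P' l

/-- Maximal fidelity under deterministic transformations,
`F^D(P → Q) = max {F(W(P), Q) | W : α → β}`. -/
noncomputable def FD [Fintype α] [Fintype β] (P : α → ℝ) (Q : β → ℝ) : ℝ :=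
  sSup {r : ℝ | ∃ W : α → β, r = fid (push W P) Q}

/-- Maximal fidelity under the majorization condition,
`F^M(P → Q) = max {F(P', Q) | P ≺ P', P'` a distribution on the target set`}`. -/
noncomputable def FM [Fintype α] [Fintype β] (P : α → ℝ) (Q : β → ℝ) : ℝ :=
  sSup {r : ℝ | ∃ P' : β → ℝ, IsProb P' ∧ Maj P P' ∧ r = fid P' Q}

/-- Shannon entropy (natural logarithm). -/
noncomputable def H [Fintype α] (P : α → ℝ) : ℝ := ∑ x, -(P x * Real.log (P x))

/-- Varentropy `V(P)` (natural logarithm). -/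
noncomputable def V [Fintype α] (P : α → ℝ) : ℝ :=
  ∑ x, P x * (-Real.log (P x) - H P) ^ 2

/-- Shannon entropy, base-2 logarithm. -/
noncomputable def H2 [Fintype α] (P : α → ℝ) : ℝ := ∑ x, -(P x * Real.logb 2 (P x))

/-- Varentropy, base-2 logarithm. -/
noncomputable def V2 [Fintype α] (P : α → ℝ) : ℝ :=
  ∑ x, P x * (-Real.logb 2 (P x) - H2 P) ^ 2

/-- The `n`-fold i.i.d. product distribution `P^n`. -/
noncomputable def iid [Fintype α] (P : α → ℝ) (n : ℕ) : (Fin n → α) → ℝ :=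
  fun f => ∏ i, P (f i)

/-- The uniform distribution on a two-element set. -/
noncomputable def U2 : Fin 2 → ℝ := fun _ => 1 / 2

/-- Density of the normal distribution `N(m, v)`. -/
noncomputable def normalPDF (m v t : ℝ) : ℝ :=
  (Real.sqrt (2 * Real.pi * v))⁻¹ * Real.exp (-(t - m) ^ 2 / (2 * v))

/-- Standard normal cumulative distribution function `G`. -/
noncomputable def stdG (x : ℝ) : ℝ := ∫ t in Set.Iic x, normalPDF 0 1 t

/-- Density `N_P` of `N(0, V(P))`. -/
noncomputable def NP [Fintype α] (P : α → ℝ) (x : ℝ) : ℝ := normalPDF 0 (V P) x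

/-- Density `N_{P,Q,b}` of `N(H(Q)b, (H(P)/H(Q))·V(Q))`. -/
noncomputable def NPQ [Fintype α] [Fintype β] (P : α → ℝ) (Q : β → ℝ) (b x : ℝ) : ℝ :=
  normalPDF (H Q * b) (H P / H Q * V Q) x

/-- Cdf `G_P(x) = G(x/√V(P))`. -/
noncomputable def GP [Fintype α] (P : α → ℝ) (x : ℝ) : ℝ := stdG (x / Real.sqrt (V P))

/-- Cdf `G_{P,Q,b}(x) = G(√(H(Q)/(H(P)V(Q)))·(x − H(Q)b))`. -/
noncomputable def GPQ [Fintype α] [Fintype β] (P : α → ℝ) (Q : β → ℝ) (b x : ℝ) : ℝ :=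
  stdG (Real.sqrt (H Q / (H P * V Q)) * (x - H Q * b))

/-- `I_{P,Q,b}(x) = ∫_{−∞}^x √(N_P(t) N_{P,Q,b}(t)) dt`. -/
noncomputable def IPQ [Fintype α] [Fintype β] (P : α → ℝ) (Q : β → ℝ) (b x : ℝ) : ℝ :=
  ∫ t in Set.Iic x, Real.sqrt (NP P t * NPQ P Q b t)

/-- `I_{P,Q,b}(∞) = ∫_ℝ √(N_P(t) N_{P,Q,b}(t)) dt`. -/
noncomputable def IPQinf [Fintype α] [Fintype β] (P : α → ℝ) (Q : β → ℝ) (b : ℝ) : ℝ :=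
  ∫ t : ℝ, Real.sqrt (NP P t * NPQ P Q b t)

/-- `L^D_n(P,Q|ν)`: the maximal `L` with `F^D(P^n → Q^L) ≥ ν`. -/
noncomputable def LD [Fintype α] [Fintype β] (P : α → ℝ) (Q : β → ℝ) (ν : ℝ) (n : ℕ) : ℕ :=
  sSup {L : ℕ | ν ≤ FD (iid P n) (iid Q L)}

/-- The optimal second order rate `R^D_2(P,Q|ν)`. -/
noncomputable def RD2 [Fintype α] [Fintype β] (P : α → ℝ) (Q : β → ℝ) (ν : ℝ) : ℝ :=
  sSup {b : ℝ | ∃ c : ℝ, ν ≤ c ∧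
    Tendsto (fun n : ℕ =>
      FD (iid P n) (iid Q (⌊H P / H Q * n + b * Real.sqrt n⌋₊))) atTop (nhds c)}

/-- Mass of the points of `Q` whose weight exceeds `t`. -/
noncomputable def upperMass [Fintype β] (Q : β → ℝ) (t : ℝ) : ℝ :=
  ∑ y with t < Q y, Q y

lemma iid_U2 (n : ℕ) : iid U2 n = fun _ => ((2 : ℝ) ^ n)⁻¹ := by
  funext f
  simp [iid, U2]

lemma push_const [Fintype α] [DecidableEq β] (W : α → β) (c : ℝ) (y : β) :
    push W (fun _ => c) y = (Finset.univ.filter fun x => W x = y).card * c := by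
  simp only [push, Finset.card_filter, Nat.cast_sum, Finset.sum_mul]
  refine Finset.sum_congr rfl fun x _ => ?_
  split_ifs <;> simp

lemma bddAbove_fid [Fintype α] [Fintype β] (R : α → ℝ) (Q : β → ℝ) :
    BddAbove {r : ℝ | ∃ W : α → β, r = fid (push W R) Q} := by
  classical
  refine (Set.Finite.subset (Set.finite_range fun W : α → β => fid (push W R) Q) ?_).bddAbove
  rintro r ⟨W, rfl⟩
  exact ⟨W, rfl⟩

lemma fid_le_FD [Fintype α] [Fintype β] (R : α → ℝ) (Q : β → ℝ) (W : α → β) :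
    fid (push W R) Q ≤ FD R Q :=
  le_csSup (bddAbove_fid R Q) ⟨W, rfl⟩

lemma FD_nonneg [Fintype α] [Fintype β] (R : α → ℝ) (Q : β → ℝ) : 0 ≤ FD R Q := by
  refine Real.sSup_nonneg ?_
  rintro r ⟨W, rfl⟩
  exact Finset.sum_nonneg fun _ _ => Real.sqrt_nonneg _

lemma upperMass_nonneg [Fintype β] (Q : β → ℝ) (hQ : ∀ y, 0 ≤ Q y) (t : ℝ) :
    0 ≤ upperMass Q t :=
  Finset.sum_nonneg fun y _ => hQ y

lemma FD_const_le [Fintype α] [Fintype β] (Q : β → ℝ) (hQ : ∀ y, 0 ≤ Q y)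
    {N : ℝ} (hN : 0 < N) (hcard : (Fintype.card α : ℝ) = N) {t : ℝ} (ht : 0 ≤ t) :
    FD (fun _ : α => N⁻¹) Q ≤ √(upperMass Q t + N * t) := by
  classical
  refine Real.sSup_le ?_ (Real.sqrt_nonneg _)
  rintro r ⟨W, rfl⟩
  set A := Finset.univ.image W
  set R := push W (fun _ : α => N⁻¹) with hR
  have hR0 : ∀ y, 0 ≤ R y := fun y => by rw [hR, push_const]; positivity
  have hRA : ∑ y ∈ A, R y ≤ 1 := by
    calc ∑ y ∈ A, R y ≤ ∑ y, R y :=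
          Finset.sum_le_sum_of_subset_of_nonneg (Finset.subset_univ _) fun y _ _ => hR0 y
      _ = 1 := by
          simp only [hR, push_const, ← Finset.sum_mul, ← Nat.cast_sum]
          rw [← Finset.card_eq_sum_card_fiberwise (f := W) (s := Finset.univ) (by simp),
            Finset.card_univ, hcard, mul_inv_cancel₀ hN.ne']
  have hQA : ∑ y ∈ A, Q y ≤ upperMass Q t + N * t := by
    rw [← Finset.sum_filter_add_sum_filter_not A (fun y => t < Q y)]
    refine add_le_add ?_ ?_
    · exact Finset.sum_le_sum_of_subset_of_nonneg
        (Finset.filter_subset_filter _ (Finset.subset_univ _)) fun y _ _ => hQ y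
    · calc ∑ y ∈ A with ¬ t < Q y, Q y ≤ ∑ y ∈ A with ¬ t < Q y, t :=
            Finset.sum_le_sum fun y hy => not_lt.1 (Finset.mem_filter.1 hy).2
        _ = (A.filter fun y => ¬ t < Q y).card * t := by rw [Finset.sum_const, nsmul_eq_mul]
        _ ≤ N * t := by
            refine mul_le_mul_of_nonneg_right ?_ ht
            rw [← hcard]
            exact_mod_cast (Finset.card_filter_le _ _).trans Finset.card_image_le
  calc fid R Q = ∑ y ∈ A, √(R y) * √(Q y) := by
        rw [fid]
        refine (Finset.sum_subset (Finset.subset_univ A) fun y _ hy => ?_).symm.trans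
          (Finset.sum_congr rfl fun y _ => Real.sqrt_mul (hR0 y) _)
        have : R y = 0 := by
          rw [hR, push_const]
          have : (Finset.univ.filter fun x => W x = y) = ∅ := by
            ext x
            simp only [Finset.mem_filter, Finset.mem_univ, true_and, Finset.notMem_empty,
              iff_false]
            rintro rfl
            exact hy (Finset.mem_image_of_mem _ (Finset.mem_univ x))
          simp [this]
        simp [this]
    _ ≤ √(∑ y ∈ A, R y) * √(∑ y ∈ A, Q y) :=
        Real.sum_sqrt_mul_sqrt_le _ (fun y => hR0 y) (fun y => hQ y)
    _ ≤ 1 * √(upperMass Q t + N * t) := by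
        refine mul_le_mul ?_ (Real.sqrt_le_sqrt hQA) (Real.sqrt_nonneg _) zero_le_one
        exact Real.sqrt_le_one.2 hRA
    _ = _ := one_mul _

/-- A map whose fibres are at least as large as prescribed. -/
lemma exists_map_le_card_fiber [Fintype α] [Fintype β] [DecidableEq β] [Nonempty β] (k : β → ℕ)
    (hk : ∑ y, k y ≤ Fintype.card α) :
    ∃ W : α → β, ∀ y, k y ≤ (Finset.univ.filter fun x => W x = y).card := by
  classical
  have hcard : Fintype.card (Σ y, Fin (k y)) ≤ Fintype.card α := by simpa using hk
  obtain ⟨e⟩ := Function.Embedding.nonempty_of_card_le hcard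
  refine ⟨fun x => if h : ∃ p, e p = x then h.choose.1 else Classical.arbitrary β, fun y => ?_⟩
  have : (Finset.univ.image fun i : Fin (k y) => e ⟨y, i⟩).card = k y := by
    rw [Finset.card_image_of_injective _ fun i j hij => by simpa using e.injective hij]
    simp
  conv_lhs => rw [← this]
  refine Finset.card_le_card fun x hx => ?_
  obtain ⟨i, -, rfl⟩ := Finset.mem_image.1 hx
  have h : ∃ p, e p = e ⟨y, i⟩ := ⟨_, rfl⟩
  simp only [Finset.mem_filter, Finset.mem_univ, true_and]
  rw [dif_pos h, e.injective h.choose_spec]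

lemma le_FD_const [Fintype α] [Fintype β] (Q : β → ℝ) (hQ : ∀ y, 0 ≤ Q y)
    {N : ℝ} (hN : 0 < N) (hcard : (Fintype.card α : ℝ) = N) {t : ℝ} (ht : 0 < t) (htN : 1 ≤ N * t)
    (hQ1 : ∑ y, Q y = 1) :
    √(upperMass Q t * (1 - (N * t)⁻¹)) ≤ FD (fun _ : α => N⁻¹) Q := by
  classical
  set q := upperMass Q t with hq
  rcases (upperMass_nonneg Q hQ t).eq_or_lt with h0 | hq0
  · rw [hq, ← h0, zero_mul, Real.sqrt_zero]
    exact FD_nonneg _ _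
  rw [← hq] at hq0
  have hq1 : q ≤ 1 := hQ1 ▸ Finset.sum_le_sum_of_subset_of_nonneg (Finset.subset_univ _)
    fun y _ _ => hQ y
  have : Nonempty β := by
    by_contra h
    rw [not_nonempty_iff] at h
    simp at hQ1
  let k : β → ℕ := fun y => if t < Q y then ⌊N * Q y / q⌋₊ else 0
  have hk : ∑ y, k y ≤ Fintype.card α := by
    have : (∑ y, k y : ℝ) ≤ N := by
      calc (∑ y, k y : ℝ) = ∑ y with t < Q y, (⌊N * Q y / q⌋₊ : ℝ) := by
            rw [Finset.sum_filter]
            exact Finset.sum_congr rfl fun y _ => by simp only [k]; split_ifs <;> simp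
        _ ≤ ∑ y with t < Q y, N * Q y / q := by
            refine Finset.sum_le_sum fun y _ => Nat.floor_le ?_
            have := hQ y
            positivity
        _ = N := by
            rw [← Finset.sum_div, ← Finset.mul_sum]
            exact mul_div_cancel_right₀ _ hq0.ne'
    rw [← hcard] at this
    exact_mod_cast this
  obtain ⟨W, hW⟩ := exists_map_le_card_fiber k hk
  refine le_trans ?_ (fid_le_FD _ _ W)
  have hc : 0 ≤ 1 - (N * t)⁻¹ := sub_nonneg.2 (inv_le_one_of_one_le₀ htN)
  calc √(q * (1 - (N * t)⁻¹)) = ∑ y with t < Q y, Q y * √((1 - (N * t)⁻¹) / q) := by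
        rw [← Finset.sum_mul]
        change _ = q * _
        rw [Real.sqrt_mul hq0.le, Real.sqrt_div hc]
        nth_rewrite 2 [← Real.mul_self_sqrt hq0.le]
        have := Real.sqrt_pos.2 hq0
        field_simp
    _ ≤ ∑ y with t < Q y, √(push W (fun _ : α => N⁻¹) y * Q y) := by
        refine Finset.sum_le_sum fun y hy => ?_
        have hty : t < Q y := (Finset.mem_filter.1 hy).2
        have hy0 : 0 < Q y := ht.trans hty
        refine Real.le_sqrt_of_sq_le ?_
        rw [mul_pow, Real.sq_sqrt (by positivity), sq, mul_assoc, mul_comm]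
        refine mul_le_mul_of_nonneg_right ?_ hy0.le
        rw [push_const]
        have h1 : N * Q y / q - 1 < k y := by
          simp only [k, if_pos hty]
          exact Nat.sub_one_lt_floor _
        have h2 : (k y : ℝ) ≤ (Finset.univ.filter fun x => W x = y).card := by
          exact_mod_cast hW y
        rw [← div_eq_mul_inv, le_div_iff₀ hN]
        refine le_trans ?_ (h1.le.trans h2)
        have h3 : q ≤ Q y / t := hq1.trans ((one_le_div ht).2 hty.le)
        have h4 : Q y * ((1 - (N * t)⁻¹) / q) * N = N * Q y / q - (Q y / t) / q := by
          field_simp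
        rw [h4]
        have : 1 ≤ Q y / t / q := (one_le_div hq0).2 h3
        linarith
    _ ≤ fid (push W fun _ : α => N⁻¹) Q :=
        Finset.sum_le_sum_of_subset_of_nonneg (Finset.subset_univ _)
          fun y _ _ => Real.sqrt_nonneg _

lemma IsProb.le_one [Fintype α] {P : α → ℝ} (hP : IsProb P) (x : α) : P x ≤ 1 :=
  hP.2 ▸ Finset.single_le_sum (fun y _ => hP.1 y) (Finset.mem_univ x)

lemma IsProb.iid [Fintype α] {P : α → ℝ} (hP : IsProb P) (n : ℕ) : IsProb (iid P n) := by
  refine ⟨fun f => Finset.prod_nonneg fun i _ => hP.1 _, ?_⟩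
  simp only [RNG.iid]
  rw [← Fintype.prod_sum fun (_ : Fin n) x => P x]
  simp [hP.2]

/-- Self-information in bits. -/
noncomputable def info (P : α → ℝ) (x : α) : ℝ := -Real.logb 2 (P x)

lemma IsProb.info_nonneg [Fintype α] {P : α → ℝ} (hP : IsProb P) (x : α) : 0 ≤ info P x :=
  neg_nonneg.2 (Real.logb_nonpos one_lt_two (hP.1 x) (hP.le_one x))

lemma H2_eq_sum_info [Fintype α] (P : α → ℝ) : H2 P = ∑ x, P x * info P x := by
  simp [H2, info]

lemma V2_eq_sum_info [Fintype α] (P : α → ℝ) : V2 P = ∑ x, P x * (info P x - H2 P) ^ 2 := rfl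

lemma H2_pos [Fintype α] {P : α → ℝ} (hP : IsProb P) (hV : 0 < V2 P) : 0 < H2 P := by
  have h0 : ∀ x ∈ Finset.univ, 0 ≤ P x * info P x := fun x _ =>
    mul_nonneg (hP.1 x) (hP.info_nonneg x)
  refine lt_of_le_of_ne (H2_eq_sum_info P ▸ Finset.sum_nonneg h0) fun h => hV.ne' ?_
  have h1 := (Finset.sum_eq_zero_iff_of_nonneg h0).1 (H2_eq_sum_info P ▸ h.symm)
  rw [V2_eq_sum_info, ← h]
  refine Finset.sum_eq_zero fun x hx => ?_
  have := h1 x hx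
  linear_combination info P x * this

/-- Probability measure on the discrete space `α` with weights `P`. -/
noncomputable def discreteMeasure [Fintype α] [MeasurableSpace α] (P : α → ℝ) : Measure α :=
  ∑ x, ENNReal.ofReal (P x) • Measure.dirac x

lemma discreteMeasure_singleton [Fintype α] [MeasurableSpace α] [MeasurableSingletonClass α]
    (P : α → ℝ) (x : α) : discreteMeasure P {x} = ENNReal.ofReal (P x) := by
  classical
  simp [discreteMeasure, Measure.finsetSum_apply, Set.indicator_apply]

lemma isProbabilityMeasure_discreteMeasure [Fintype α] [MeasurableSpace α]
    {P : α → ℝ} (hP : IsProb P) : IsProbabilityMeasure (discreteMeasure P) := by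
  constructor
  simp only [discreteMeasure, Measure.finsetSum_apply, Measure.smul_apply, measure_univ,
    smul_eq_mul, mul_one]
  rw [← ENNReal.ofReal_sum_of_nonneg fun x _ => hP.1 x, hP.2, ENNReal.ofReal_one]

lemma discreteMeasure_real_singleton [Fintype α] [MeasurableSpace α] [MeasurableSingletonClass α]
    {P : α → ℝ} (hP : IsProb P) (x : α) : (discreteMeasure P).real {x} = P x := by
  rw [Measure.real, discreteMeasure_singleton, ENNReal.toReal_ofReal (hP.1 x)]

lemma integral_discreteMeasure [Fintype α] [MeasurableSpace α] [MeasurableSingletonClass α]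
    {P : α → ℝ} (hP : IsProb P) (f : α → ℝ) :
    ∫ x, f x ∂discreteMeasure P = ∑ x, P x * f x := by
  have := isProbabilityMeasure_discreteMeasure hP
  rw [integral_fintype Integrable.of_finite]
  simp [discreteMeasure_real_singleton hP]

/-- Probability that the self-information of the first `L` letters of an i.i.d. sequence with
letter distribution `P` is below `s`. -/
noncomputable def infoCDF [Fintype α] [MeasurableSpace α] (P : α → ℝ) (L : ℕ) (s : ℝ) : ℝ :=
  (Measure.infinitePi fun _ : ℕ => discreteMeasure P).real
    {ω | ∑ i ∈ Finset.range L, info P (ω i) < s}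

lemma infoCDF_anti [Fintype α] [MeasurableSpace α] {P : α → ℝ} (hP : IsProb P) {L L' : ℕ}
    (h : L ≤ L') (s : ℝ) : infoCDF P L' s ≤ infoCDF P L s := by
  have := isProbabilityMeasure_discreteMeasure hP
  refine measureReal_mono fun ω (hω : _ < s) => lt_of_le_of_lt ?_ hω
  exact Finset.sum_le_sum_of_subset_of_nonneg (Finset.range_mono h) fun i _ _ =>
    hP.info_nonneg _

lemma rpow_lt_prod_iff {ι : Type*} [Fintype ι] {P : α → ℝ} (f : ι → α) (hf : ∀ i, 0 < P (f i))
    (s : ℝ) : (2 : ℝ) ^ (-s) < ∏ i, P (f i) ↔ ∑ i, info P (f i) < s := by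
  rw [← Real.lt_logb_iff_rpow_lt one_lt_two (Finset.prod_pos fun i _ => hf i),
    Real.logb_prod _ _ fun i _ => (hf i).ne']
  simp only [info, Finset.sum_neg_distrib]
  exact neg_lt

lemma upperMass_iid [Fintype α] [MeasurableSpace α] [MeasurableSingletonClass α]
    {P : α → ℝ} (hP : IsProb P) (L : ℕ) (s : ℝ) :
    upperMass (iid P L) ((2 : ℝ) ^ (-s)) = infoCDF P L s := by
  classical
  have := isProbabilityMeasure_discreteMeasure hP
  set μ := discreteMeasure P
  set M := Measure.infinitePi fun _ : ℕ => μ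
  have hmap : M.map (fun ω (i : Fin L) => ω i) = Measure.infinitePi fun _ : Fin L => μ :=
    Measure.map_infinitePi_infinitePi_of_inj (P := fun _ => μ) Fin.val_injective
  have hset : {ω : ℕ → α | ∑ i ∈ Finset.range L, info P (ω i) < s} =
      (fun ω (i : Fin L) => ω i) ⁻¹'
        ↑(Finset.univ.filter fun f : Fin L → α => ∑ i, info P (f i) < s) := by
    ext ω
    simp [Finset.sum_range]
  rw [infoCDF, hset, ← map_measureReal_apply (by fun_prop) (Finset.measurableSet _), hmap,
    ← sum_measureReal_singleton, upperMass, Finset.sum_filter, Finset.sum_filter]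
  refine Finset.sum_congr rfl fun f _ => ?_
  have hf : (Measure.infinitePi fun _ : Fin L => μ).real {f} = iid P L f := by
    rw [Measure.real, Measure.infinitePi_singleton_of_fintype, ENNReal.toReal_prod]
    exact Finset.prod_congr rfl fun i _ => discreteMeasure_real_singleton hP _
  rw [hf]
  by_cases h0 : ∀ i, 0 < P (f i)
  · simp only [iid, rpow_lt_prod_iff f h0]
  · have : iid P L f = 0 := by
      push Not at h0
      obtain ⟨i, hi⟩ := h0
      exact Finset.prod_eq_zero (Finset.mem_univ i) (le_antisymm hi (hP.1 _))
    simp [this]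

lemma FD_U2_le [Fintype α] [MeasurableSpace α] [MeasurableSingletonClass α]
    {P : α → ℝ} (hP : IsProb P) (n L : ℕ) (s : ℝ) :
    FD (iid U2 n) (iid P L) ≤ √(infoCDF P L s + (2 : ℝ) ^ ((n : ℝ) - s)) := by
  rw [iid_U2, ← upperMass_iid hP, Real.rpow_sub two_pos, Real.rpow_natCast, div_eq_mul_inv,
    ← Real.rpow_neg two_pos.le]
  exact FD_const_le _ (hP.iid L).1 (by positivity) (by simp) (by positivity)

lemma le_FD_U2 [Fintype α] [MeasurableSpace α] [MeasurableSingletonClass α]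
    {P : α → ℝ} (hP : IsProb P) (n L : ℕ) {s : ℝ} (hs : s ≤ n) :
    √(infoCDF P L s * (1 - (2 : ℝ) ^ (s - n))) ≤ FD (iid U2 n) (iid P L) := by
  have h : (2 : ℝ) ^ (s - n) = ((2 : ℝ) ^ n * (2 : ℝ) ^ (-s))⁻¹ := by
    rw [← Real.rpow_natCast, ← Real.rpow_add two_pos, ← Real.rpow_neg two_pos.le]
    ring_nf
  rw [iid_U2, ← upperMass_iid hP, h]
  refine le_FD_const _ (hP.iid L).1 (by positivity) (by simp) (by positivity) ?_ (hP.iid L).2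
  rw [← Real.rpow_natCast, ← Real.rpow_add two_pos]
  exact Real.one_le_rpow one_le_two (by linarith)

lemma normalPDF_zero_one : normalPDF 0 1 = ProbabilityTheory.gaussianPDFReal 0 1 := by
  funext t
  simp [normalPDF, ProbabilityTheory.gaussianPDFReal]

lemma stdG_eq_integral_gaussianPDFReal (x : ℝ) :
    stdG x = ∫ t in Set.Iic x, ProbabilityTheory.gaussianPDFReal 0 1 t := by
  rw [stdG, normalPDF_zero_one]

lemma stdG_eq_gaussianReal (x : ℝ) :
    stdG x = (ProbabilityTheory.gaussianReal 0 1).real (Set.Iic x) := by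
  rw [Measure.real, ProbabilityTheory.gaussianReal_apply_eq_integral _ one_ne_zero,
    stdG_eq_integral_gaussianPDFReal, ENNReal.toReal_ofReal]
  exact integral_nonneg fun t => ProbabilityTheory.gaussianPDFReal_nonneg _ _ _

lemma stdG_strictMono : StrictMono stdG := by
  intro x y hxy
  have hint := ProbabilityTheory.integrable_gaussianPDFReal 0 1
  rw [← sub_pos, stdG_eq_integral_gaussianPDFReal, stdG_eq_integral_gaussianPDFReal,
    intervalIntegral.integral_Iic_sub_Iic hint.integrableOn hint.integrableOn]
  exact intervalIntegral.intervalIntegral_pos_of_pos hint.intervalIntegrable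
    (fun t => ProbabilityTheory.gaussianPDFReal_pos _ _ _ one_ne_zero) hxy

lemma stdG_nonneg (x : ℝ) : 0 ≤ stdG x := by
  rw [stdG_eq_gaussianReal]
  exact measureReal_nonneg

open ProbabilityTheory in
/-- Central limit theorem for the self-information, along a sequence of block lengths and with
varying thresholds. -/
lemma tendsto_infoCDF [Fintype α] [MeasurableSpace α] [MeasurableSingletonClass α]
    {P : α → ℝ} (hP : IsProb P) (hV : 0 < V2 P) {L : ℕ → ℕ} (hL : Tendsto L atTop atTop)
    {s : ℕ → ℝ} {t : ℝ}
    (ht : Tendsto (fun n => (s n - L n * H2 P) / (√(L n) * √(V2 P))) atTop (nhds t)) :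
    Tendsto (fun n => infoCDF P (L n) (s n)) atTop (nhds (stdG t)) := by
  have := isProbabilityMeasure_discreteMeasure hP
  set μ := discreteMeasure P
  set M := Measure.infinitePi fun _ : ℕ => μ
  have hσ : 0 < √(V2 P) := Real.sqrt_pos.2 hV
  let u : α → ℝ := fun x => (info P x - H2 P) / √(V2 P)
  have hu : Measurable u := measurable_of_finite _
  let Z : ℕ → (ℕ → α) → ℝ := fun i ω => u (ω i)
  have hmp (i : ℕ) : MeasurePreserving (Function.eval i) M μ := measurePreserving_eval_infinitePi _ i
  have hint (f : α → ℝ) : ∫ ω, f (ω 0) ∂M = ∑ x, P x * f x := by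
    rw [← integral_discreteMeasure hP]
    change _ = ∫ x, f x ∂μ
    rw [← (hmp 0).map_eq, integral_map (hmp 0).aemeasurable
      (measurable_of_finite f).aestronglyMeasurable]
  have h0 : ∫ ω, Z 0 ω ∂M = 0 := by
    simp only [Z]
    rw [hint]
    simp only [u, ← mul_div_assoc, ← Finset.sum_div, mul_sub, Finset.sum_sub_distrib,
      ← Finset.sum_mul, hP.2, ← H2_eq_sum_info]
    simp
  have h1 : ∫ ω, (Z 0 ^ 2) ω ∂M = 1 := by
    simp only [Z, Pi.pow_apply]
    rw [hint fun x => u x ^ 2]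
    simp only [u, div_pow, ← mul_div_assoc, ← Finset.sum_div, ← V2_eq_sum_info,
      Real.sq_sqrt hV.le]
    exact div_self hV.ne'
  have hindep : iIndepFun Z M := iIndepFun_infinitePi (X := fun _ => u) fun _ => hu
  have hident (i : ℕ) : IdentDistrib (Z i) (Z 0) M M := by
    have h : IdentDistrib (fun ω : ℕ → α => ω i) (fun ω => ω 0) M M :=
      ⟨(hmp i).aemeasurable, (hmp 0).aemeasurable, (hmp i).map_eq.trans (hmp 0).map_eq.symm⟩
    exact h.comp hu
  have hclt := tendstoInDistribution_inv_sqrt_mul_sum (P' := gaussianReal 0 1) (Y := id)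
    HasLaw.id h0 h1 hindep hident
  have hsub : TendstoInDistribution
      (fun (n : ℕ) ω ↦ (√(L n))⁻¹ * ∑ k ∈ Finset.range (L n), Z k ω) atTop id
      (fun _ ↦ M) (gaussianReal 0 1) :=
    ⟨fun n => hclt.forall_aemeasurable (L n), hclt.aemeasurable_limit, hclt.tendsto.comp hL⟩
  have hslut := hsub.add_of_tendstoInMeasure_const
    (Y := fun n _ => -((s n - L n * H2 P) / (√(L n) * √(V2 P)))) (c := -t)
    (tendstoInMeasure_of_tendsto_ae (fun _ => aestronglyMeasurable_const)
      (ae_of_all _ fun _ => ht.neg)) fun _ => aemeasurable_const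
  have hfr : (gaussianReal 0 1).map (fun ω : ℝ => id ω + -t) (frontier (Set.Iio 0)) = 0 := by
    rw [frontier_Iio, Measure.map_apply (by fun_prop) (measurableSet_singleton _)]
    have : (fun ω : ℝ => id ω + -t) ⁻¹' {0} = {t} := by
      ext x
      simp
    have hna : NullSingletonClass (gaussianReal 0 1) :=
      nullSingletonClass_gaussianReal one_ne_zero
    rw [this, measure_singleton]
  have hfin : (gaussianReal 0 1).map (fun ω : ℝ => id ω + -t) (Set.Iio 0) ≠ ⊤ :=
    measure_ne_top _ _
  have hpm := (ENNReal.tendsto_toReal hfin).comp <|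
    ProbabilityMeasure.tendsto_measure_of_null_frontier_of_tendsto' hslut.tendsto hfr
  have hlim : ((gaussianReal 0 1).map (fun ω : ℝ => id ω + -t) (Set.Iio 0)).toReal = stdG t := by
    have hna : NullSingletonClass (gaussianReal 0 1) :=
      nullSingletonClass_gaussianReal one_ne_zero
    rw [Measure.map_apply (by fun_prop) measurableSet_Iio, stdG_eq_gaussianReal, Measure.real,
      ← measure_congr (Iio_ae_eq_Iic (μ := gaussianReal 0 1) (a := t))]
    congr 2
    ext x
    simp
  rw [← hlim]
  refine hpm.congr' ?_
  filter_upwards [hL.eventually_gt_atTop 0] with n hn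
  have hsL : 0 < √(L n : ℝ) := Real.sqrt_pos.2 (by exact_mod_cast hn)
  have hmeas := hslut.forall_aemeasurable n
  change (Measure.map _ M (Set.Iio 0)).toReal = _
  rw [Measure.map_apply_of_aemeasurable hmeas measurableSet_Iio, infoCDF, Measure.real]
  congr 2
  ext ω
  have : ∑ k ∈ Finset.range (L n), Z k ω =
      (∑ i ∈ Finset.range (L n), info P (ω i) - L n * H2 P) / √(V2 P) := by
    simp only [Z, u, ← Finset.sum_div, Finset.sum_sub_distrib]
    simp
  simp only [Set.mem_preimage, Pi.add_apply, Set.mem_Iio, Set.mem_ofPred_eq, this,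
    add_neg_lt_iff_lt_add, zero_add]
  rw [inv_mul_eq_div, div_div, mul_comm (√(V2 P)), div_lt_div_iff_of_pos_right (by positivity)]
  exact sub_lt_sub_iff_right _

lemma tendsto_sqrt_natCast : Tendsto (fun n : ℕ => √(n : ℝ)) atTop atTop :=
  Real.tendsto_sqrt_atTop.comp tendsto_natCast_atTop_atTop

lemma tendsto_div_of_second_order {L : ℕ → ℕ} {a b : ℝ}
    (hL : Tendsto (fun n : ℕ => (L n - a * n) / √n) atTop (nhds b)) :
    Tendsto (fun n : ℕ => (L n : ℝ) / n) atTop (nhds a) := by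
  have h := (hL.mul tendsto_sqrt_natCast.inv_tendsto_atTop).add_const a
  rw [mul_zero, zero_add] at h
  refine h.congr' ?_
  filter_upwards [eventually_gt_atTop 0] with n hn
  have hn' : (0 : ℝ) < n := by exact_mod_cast hn
  simp only [Pi.inv_apply]
  rw [← div_eq_mul_inv, div_div, Real.mul_self_sqrt hn'.le]
  field_simp
  ring

lemma tendsto_atTop_of_second_order {L : ℕ → ℕ} {a b : ℝ} (ha : 0 < a)
    (hL : Tendsto (fun n : ℕ => (L n - a * n) / √n) atTop (nhds b)) :
    Tendsto L atTop atTop := by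
  rw [← tendsto_natCast_atTop_iff (R := ℝ)]
  refine ((tendsto_div_of_second_order hL).pos_mul_atTop ha
    tendsto_natCast_atTop_atTop).congr' ?_
  filter_upwards [eventually_gt_atTop 0] with n hn
  have hn' : (n : ℝ) ≠ 0 := by exact_mod_cast hn.ne'
  exact div_mul_cancel₀ _ hn'

/-- Limit of the information spectrum in the second-order regime. -/
lemma tendsto_infoCDF_second_order [Fintype α] [MeasurableSpace α] [MeasurableSingletonClass α]
    {P : α → ℝ} (hP : IsProb P) (hV : 0 < V2 P) {L : ℕ → ℕ} {b : ℝ}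
    (hL : Tendsto (fun n : ℕ => (L n - (H2 P)⁻¹ * n) / √n) atTop (nhds b))
    {e : ℕ → ℝ} (he : Tendsto (fun n : ℕ => e n / √n) atTop (nhds 0)) :
    Tendsto (fun n : ℕ => infoCDF P (L n) (n + e n)) atTop
      (nhds (stdG (-(√(H2 P ^ 3 / V2 P) * b)))) := by
  have hH := H2_pos hP hV
  have hratio := tendsto_div_of_second_order hL
  have htop := tendsto_atTop_of_second_order (inv_pos.2 hH) hL
  refine tendsto_infoCDF hP hV htop ?_
  have h1 := (((he.sub (hL.const_mul (H2 P))).div (hratio.sqrt)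
    (Real.sqrt_pos.2 (inv_pos.2 hH)).ne').div_const √(V2 P))
  have hlim : (0 - H2 P * b) / √(H2 P)⁻¹ / √(V2 P) = -(√(H2 P ^ 3 / V2 P) * b) := by
    have h3 : √(H2 P ^ 3) = H2 P * √(H2 P) := by
      rw [pow_succ, Real.sqrt_mul (by positivity), Real.sqrt_sq hH.le]
    rw [Real.sqrt_div (by positivity), h3, Real.sqrt_inv]
    field_simp
    ring
  rw [hlim] at h1
  refine h1.congr' ?_
  filter_upwards [eventually_gt_atTop 0, htop.eventually_gt_atTop 0] with n hn hLn
  have hn' : (0 : ℝ) < n := by exact_mod_cast hn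
  have hL' : (0 : ℝ) < L n := by exact_mod_cast hLn
  have hV' := Real.sqrt_pos.2 hV
  have hsn := Real.sqrt_pos.2 hn'
  have hsL := Real.sqrt_pos.2 hL'
  simp only [Pi.div_apply]
  rw [Real.sqrt_div hL'.le]
  field_simp
  ring

/-- A margin that is unbounded but of smaller order than `√n`. -/
noncomputable def margin (n : ℕ) : ℝ := √(√n)

lemma margin_nonneg (n : ℕ) : 0 ≤ margin n := Real.sqrt_nonneg _

lemma tendsto_margin : Tendsto margin atTop atTop :=
  Real.tendsto_sqrt_atTop.comp tendsto_sqrt_natCast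

lemma tendsto_margin_div : Tendsto (fun n : ℕ => margin n / √n) atTop (nhds 0) := by
  refine tendsto_margin.inv_tendsto_atTop.congr' (Eventually.of_forall fun n => ?_)
  simp only [Pi.inv_apply, margin]
  rw [Real.sqrt_div_self']
  simp

lemma tendsto_two_rpow_neg_margin :
    Tendsto (fun n : ℕ => (2 : ℝ) ^ (-margin n)) atTop (nhds 0) := by
  exact (tendsto_rpow_atBot_of_base_gt_one 2 one_lt_two).comp
    (tendsto_neg_atTop_atBot.comp tendsto_margin)

section

variable {X : Type*} [Fintype X] {P : X → ℝ} {L : ℕ → ℕ} {b : ℝ}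

/-- Upper bound for the fidelity, uniform in all block lengths beyond `L n`. -/
lemma exists_FD_bound (hP : IsProb P) (hV : 0 < V2 P)
    (hL : Tendsto (fun n : ℕ => (L n - (H2 P)⁻¹ * n) / √n) atTop (nhds b)) :
    ∃ B : ℕ → ℝ, (∀ n l, L n ≤ l → FD (iid U2 n) (iid P l) ≤ B n) ∧
      Tendsto B atTop (nhds √(stdG (-(√(H2 P ^ 3 / V2 P) * b)))) := by
  let : MeasurableSpace X := ⊤
  refine ⟨fun n => √(infoCDF P (L n) (n + margin n) + (2 : ℝ) ^ (-margin n)),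
    fun n l hl => ?_, ?_⟩
  · refine (FD_U2_le hP n l (n + margin n)).trans (Real.sqrt_le_sqrt ?_)
    rw [sub_add_cancel_left]
    gcongr
    exact infoCDF_anti hP hl _
  · have := (tendsto_infoCDF_second_order hP hV hL tendsto_margin_div).add
      tendsto_two_rpow_neg_margin
    rw [add_zero] at this
    exact this.sqrt

lemma tendsto_FD_second_order (hP : IsProb P) (hV : 0 < V2 P)
    (hL : Tendsto (fun n : ℕ => (L n - (H2 P)⁻¹ * n) / √n) atTop (nhds b)) :
    Tendsto (fun n => FD (iid U2 n) (iid P (L n))) atTop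
      (nhds √(stdG (-(√(H2 P ^ 3 / V2 P) * b)))) := by
  let : MeasurableSpace X := ⊤
  obtain ⟨B, hB, hBt⟩ := exists_FD_bound hP hV hL
  have hm : Tendsto (fun n : ℕ => -margin n / √n) atTop (nhds 0) := by
    simpa [neg_div] using tendsto_margin_div.neg
  have hlow := ((tendsto_infoCDF_second_order hP hV hL hm).mul
    (tendsto_two_rpow_neg_margin.const_sub 1)).sqrt
  rw [sub_zero, mul_one] at hlow
  refine tendsto_of_tendsto_of_tendsto_of_le_of_le hlow hBt (fun n => ?_) fun n => hB n _ le_rfl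
  have h := le_FD_U2 hP n (L n) (s := n + -margin n) (by linarith [margin_nonneg n])
  rwa [add_sub_cancel_left] at h

end

lemma tendsto_floor_second_order {a : ℝ} (ha : 0 < a) (b : ℝ) :
    Tendsto (fun n : ℕ => ((⌊a * n + b * √n⌋₊ : ℝ) - a * n) / √n) atTop (nhds b) := by
  have hnonneg : ∀ᶠ n : ℕ in atTop, 0 ≤ a * n + b * √n := by
    filter_upwards [tendsto_sqrt_natCast.eventually_ge_atTop (-b / a)] with n hn
    have h : (n : ℝ) = √n * √n := (Real.mul_self_sqrt n.cast_nonneg).symm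
    have h2 : 0 ≤ a * √n + b := by
      rw [div_le_iff₀ ha] at hn
      linarith
    calc (0 : ℝ) ≤ √n * (a * √n + b) := mul_nonneg (Real.sqrt_nonneg _) h2
      _ = a * (√n * √n) + b * √n := by ring
      _ = a * n + b * √n := by rw [← h]
  have hlow : Tendsto (fun n : ℕ => b - (√(n : ℝ))⁻¹) atTop (nhds b) := by
    simpa using tendsto_sqrt_natCast.inv_tendsto_atTop.const_sub b
  refine tendsto_of_tendsto_of_tendsto_of_le_of_le' hlow tendsto_const_nhds ?_ ?_
  · filter_upwards [eventually_gt_atTop 0] with n hn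
    have hsn : 0 < √(n : ℝ) := Real.sqrt_pos.2 (by exact_mod_cast hn)
    rw [le_div_iff₀ hsn, sub_mul, inv_mul_cancel₀ hsn.ne']
    linarith [Nat.sub_one_lt_floor (a * n + b * √n)]
  · filter_upwards [eventually_gt_atTop 0, hnonneg] with n hn h0
    have hsn : 0 < √(n : ℝ) := Real.sqrt_pos.2 (by exact_mod_cast hn)
    rw [div_le_iff₀ hsn]
    linarith [Nat.floor_le h0]

lemma H_U2_div_H [Fintype α] (P : α → ℝ) : H U2 / H P = (H2 P)⁻¹ := by
  have hU : H U2 = Real.log 2 := by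
    simp [H, U2]
  have hP : H P = H2 P * Real.log 2 := by
    simp only [H, H2, Finset.sum_mul]
    refine Finset.sum_congr rfl fun x _ => ?_
    have := Real.log_pos one_lt_two
    rw [Real.logb]
    field_simp
  rw [hU, hP, div_mul_cancel_right₀ (Real.log_pos one_lt_two).ne']

/-- second order expansion of `L^D_n(U_2, P | ν)`
(entropy and varentropy in base 2); `g = G⁻¹(ν²)`. -/
theorem second_order_rate_uniform_source {X : Type*} [Fintype X]
    (P : X → ℝ) (hP : IsProb P) (hV : 0 < V2 P)
    (ν : ℝ) (hν : 0 < ν ∧ ν < 1) (g : ℝ) (hg : stdG g = ν ^ 2) :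
    Tendsto (fun n : ℕ => ((LD U2 P ν n : ℝ) - (H2 P)⁻¹ * n) / Real.sqrt n) atTop
      (nhds (-(Real.sqrt (V2 P / H2 P ^ 3) * g))) ∧
    RD2 U2 P ν = -(Real.sqrt (V2 P / H2 P ^ 3) * g) := by
  have hH := H2_pos hP hV
  have ha : 0 < (H2 P)⁻¹ := inv_pos.2 hH
  set κ := √(H2 P ^ 3 / V2 P) with hκ
  have hκ0 : 0 < κ := Real.sqrt_pos.2 (by positivity)
  have hbstar : -(√(V2 P / H2 P ^ 3) * g) = -g / κ := by
    rw [hκ, ← inv_div, Real.sqrt_inv]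
    ring
  rw [hbstar]
  have hFD (b : ℝ) := tendsto_FD_second_order hP hV (tendsto_floor_second_order ha b)
  have hle (b : ℝ) : ν ≤ √(stdG (-(κ * b))) ↔ b ≤ -g / κ := by
    rw [Real.le_sqrt hν.1.le (stdG_nonneg _), ← hg, stdG_strictMono.le_iff_le, le_div_iff₀ hκ0]
    constructor <;> intro h <;> linarith
  constructor
  · have hupper (b : ℝ) (hb : -g / κ < b) :
        ∀ᶠ n in atTop, ∀ l, ν ≤ FD (iid U2 n) (iid P l) → l < ⌊(H2 P)⁻¹ * n + b * √n⌋₊ := by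
      obtain ⟨B, hB, hBt⟩ := exists_FD_bound hP hV (tendsto_floor_second_order ha b)
      filter_upwards [hBt.eventually_lt_const (not_le.1 (mt (hle b).1 hb.not_ge))] with n hn l hl
      exact lt_of_not_ge fun h => ((hl.trans (hB n l h)).trans_lt hn).false
    refine tendsto_order.2 ⟨fun x hx => ?_, fun x hx => ?_⟩
    · obtain ⟨b, hxb, hb⟩ := exists_between hx
      have hν_lt : ν < √(stdG (-(κ * b))) := by
        rw [Real.lt_sqrt hν.1.le, ← hg, stdG_strictMono.lt_iff_lt]
        rw [lt_div_iff₀ hκ0] at hb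
        linarith
      filter_upwards [(hFD b).eventually_const_lt hν_lt, hupper (-g / κ + 1) (by linarith),
        (tendsto_floor_second_order ha b).eventually_const_lt hxb] with n h1 h2 h3
      refine h3.trans_le ?_
      have : ⌊(H2 P)⁻¹ * n + b * √n⌋₊ ≤ LD U2 P ν n :=
        le_csSup ⟨_, fun l hl => (h2 l hl).le⟩ h1.le
      gcongr
    · obtain ⟨b, hb, hbx⟩ := exists_between hx
      filter_upwards [hupper b hb,
        (tendsto_floor_second_order ha b).eventually_lt_const hbx] with n h1 h2
      refine lt_of_le_of_lt ?_ h2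
      have : LD U2 P ν n ≤ ⌊(H2 P)⁻¹ * n + b * √n⌋₊ :=
        csSup_le' fun l hl => (h1 l hl).le
      gcongr
  · rw [RD2, H_U2_div_H]
    refine (congrArg sSup (Set.ext fun b => ?_)).trans csSup_Iic
    simp only [Set.mem_Iic, ← hle b]
    exact ⟨fun ⟨c, hc, h⟩ => tendsto_nhds_unique h (hFD b) ▸ hc, fun h => ⟨_, h, hFD b⟩⟩

end RNG
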